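/- Let R ∈ ℝ^{n×n} be row-stochastic, π_R ∈ ℝⁿ with π_Rᵀ R = π_Rᵀ and π_Rᵀ 𝟙 = 1, and Π_R := 𝟙 π_Rᵀ. Let π_C ∈ ℝⁿ and Π_C := π_C 𝟙ᵀ. Let S_R, S_C ∈ ℝ^{n×n} be invertible, ρ ∈ (0,1), κ ≥ 0, and δ > 0 be such that for all X, Y ∈ ℝ^{n×d}: ‖S_R(R X − Π_R X)‖_F ≤ ρ ‖S_R(X − Π_R X)‖_F, ‖S_R(R − Π_R) Y‖_F ≤ κ ‖S_R Y‖_F, and ‖S_R Y‖_F ≤ δ ‖S_C Y‖_F. Then for any X, V ∈ ℝ^{n×d}, any η ∈ ℝ, setting X⁺ := R(X − η V) and m̄ := (1/n) Vᵀ 𝟙, one has ‖S_R(X⁺ − Π_R X⁺)‖_F² ≤ ((1 + ρ²)/2) ‖S_R(X − Π_R X)‖_F² + (2 κ² (1 + ρ²)/(1 − ρ²)) η² δ² ‖S_C(V − Π_C V)‖_F² + (2 κ² (1 + ρ²)/(1 − ρ²)) η² n² ‖S_R π_C‖₂² ‖m̄‖₂². -/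

import Mathlib

open Matrix BigOperators

/-- The stationary projection `Π_R = 𝟙 πᵀ` associated with a row-stochastic matrix. -/
noncomputable def projR {n : ℕ} (π : Fin n → ℝ) : Matrix (Fin n) (Fin n) ℝ :=
  Matrix.vecMulVec (fun _ => (1 : ℝ)) π

/-- The stationary projection `Π_C = π 𝟙ᵀ` associated with a column-stochastic matrix. -/
noncomputable def projC {n : ℕ} (π : Fin n → ℝ) : Matrix (Fin n) (Fin n) ℝ :=
  Matrix.vecMulVec π (fun _ => (1 : ℝ))

/-- Frobenius norm of an `n × d` real matrix. -/
noncomputable def frobNorm {n d : ℕ} (X : Matrix (Fin n) (Fin d) ℝ) : ℝ :=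
  Real.sqrt (∑ i, ∑ j, (X i j) ^ 2)

/-- Euclidean norm of a vector. -/
noncomputable def euclNorm {k : ℕ} (v : Fin k → ℝ) : ℝ :=
  Real.sqrt (∑ i, (v i) ^ 2)

theorem frob_sq {n d : ℕ} (X : Matrix (Fin n) (Fin d) ℝ) :
    frobNorm X ^ 2 = ∑ i, ∑ j, (X i j) ^ 2 :=
  Real.sq_sqrt (Finset.sum_nonneg fun _ _ => Finset.sum_nonneg fun _ _ => sq_nonneg _)

theorem eucl_sq {n : ℕ} (v : Fin n → ℝ) : euclNorm v ^ 2 = ∑ i, (v i) ^ 2 :=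
  Real.sq_sqrt (Finset.sum_nonneg fun _ _ => sq_nonneg _)

theorem frob_nonneg {n d : ℕ} (X : Matrix (Fin n) (Fin d) ℝ) : 0 ≤ frobNorm X :=
  Real.sqrt_nonneg _

theorem frob_add {n d : ℕ} (p r : ℝ) (h : ∀ a b : ℝ, (a + b) ^ 2 ≤ p * a ^ 2 + r * b ^ 2)
    (A B : Matrix (Fin n) (Fin d) ℝ) :
    frobNorm (A + B) ^ 2 ≤ p * frobNorm A ^ 2 + r * frobNorm B ^ 2 := by
  simp only [frob_sq, Finset.mul_sum, ← Finset.sum_add_distrib]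
  exact Finset.sum_le_sum fun i _ => Finset.sum_le_sum fun j _ => h _ _

theorem frob_smul {n d : ℕ} (c : ℝ) (A : Matrix (Fin n) (Fin d) ℝ) :
    frobNorm (c • A) ^ 2 = c ^ 2 * frobNorm A ^ 2 := by
  simp only [frob_sq, Finset.mul_sum, Matrix.smul_apply, smul_eq_mul, mul_pow]

theorem frob_vecMulVec {n d : ℕ} (u : Fin n → ℝ) (v : Fin d → ℝ) :
    frobNorm (vecMulVec u v) ^ 2 = euclNorm u ^ 2 * euclNorm v ^ 2 := by
  simp only [frob_sq, eucl_sq, vecMulVec_apply, mul_pow, Finset.sum_mul_sum]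

/-- **Full one-step consensus error bound in the Push-Pull setting.** -/
theorem consensus_error_push_pull {n d : ℕ} (R : Matrix (Fin n) (Fin n) ℝ)
    (hR_nonneg : ∀ i j, 0 ≤ R i j) (hR_row : ∀ i, ∑ j, R i j = 1)
    (πR : Fin n → ℝ) (hπR_stat : Matrix.vecMul πR R = πR) (hπR_sum : ∑ i, πR i = 1)
    (πC : Fin n → ℝ)
    (SR SC : Matrix (Fin n) (Fin n) ℝ) (hSR : IsUnit SR) (hSC : IsUnit SC)
    (ρ κ δ : ℝ) (hρ : ρ ∈ Set.Ioo (0 : ℝ) 1) (hκ : 0 ≤ κ) (hδ : 0 < δ)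
    (hcontract : ∀ X : Matrix (Fin n) (Fin d) ℝ,
      frobNorm (SR * (R * X - projR πR * X)) ≤ ρ * frobNorm (SR * (X - projR πR * X)))
    (hbound : ∀ Y : Matrix (Fin n) (Fin d) ℝ,
      frobNorm (SR * ((R - projR πR) * Y)) ≤ κ * frobNorm (SR * Y))
    (hequiv : ∀ Y : Matrix (Fin n) (Fin d) ℝ, frobNorm (SR * Y) ≤ δ * frobNorm (SC * Y))
    (X V : Matrix (Fin n) (Fin d) ℝ) (η : ℝ) :
    frobNorm (SR * (R * (X - η • V) - projR πR * (R * (X - η • V)))) ^ 2 ≤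
      (1 + ρ ^ 2) / 2 * frobNorm (SR * (X - projR πR * X)) ^ 2
        + (2 * κ ^ 2 * (1 + ρ ^ 2) / (1 - ρ ^ 2)) * η ^ 2 * δ ^ 2
            * frobNorm (SC * (V - projC πC * V)) ^ 2
        + (2 * κ ^ 2 * (1 + ρ ^ 2) / (1 - ρ ^ 2)) * η ^ 2 * (n : ℝ) ^ 2
            * euclNorm (SR.mulVec πC) ^ 2
            * euclNorm (fun j => (1 / (n : ℝ)) * ∑ i, V i j) ^ 2 := by
  obtain ⟨hρ0, hρ1⟩ := hρ
  have hn : (n : ℝ) ≠ 0 := by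
    rintro h
    have : n = 0 := by exact_mod_cast h
    subst this
    simp at hπR_sum
  have hs0 : 0 < ρ ^ 2 := by positivity
  have hs1 : 0 < 1 - ρ ^ 2 := by nlinarith
  have hPR : projR πR * R = projR πR := by
    rw [projR, vecMulVec_mul, hπR_stat]
  have e1 : SR * (R * (X - η • V) - projR πR * (R * (X - η • V))) =
      SR * (R * X - projR πR * X) + (-η) • (SR * ((R - projR πR) * V)) := by
    rw [← Matrix.mul_assoc (projR πR), hPR]
    simp only [Matrix.mul_sub, Matrix.sub_mul, Matrix.mul_smul, neg_smul, smul_sub]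
    abel
  have hA := pow_le_pow_left₀ (frob_nonneg _) (hcontract X) 2
  have hB := pow_le_pow_left₀ (frob_nonneg _) (hbound V) 2
  have hD := pow_le_pow_left₀ (frob_nonneg _) (hequiv (V - projC πC * V)) 2
  rw [mul_pow] at hA hB hD
  have e2 : SR * V = SR * (V - projC πC * V) + SR * (projC πC * V) := by
    rw [← Matrix.mul_add, sub_add_cancel]
  have h2 := frob_add 2 2 (fun a b => by nlinarith [sq_nonneg (a - b)])
    (SR * (V - projC πC * V)) (SR * (projC πC * V))
  rw [← e2] at h2
  have e3 : SR * (projC πC * V) =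
      (n : ℝ) • vecMulVec (SR.mulVec πC) (fun j => (1 / (n : ℝ)) * ∑ i, V i j) := by
    rw [projC, vecMulVec_mul, mul_vecMulVec]
    ext i j
    simp only [vecMulVec_apply, Matrix.smul_apply, smul_eq_mul, vecMul, dotProduct, one_mul]
    field_simp
  rw [e3, frob_smul, frob_vecMulVec] at h2
  have h1 := frob_add ((1 + ρ ^ 2) / (2 * ρ ^ 2)) ((1 + ρ ^ 2) / (1 - ρ ^ 2))
    (fun a b => by
      have : (1 + ρ ^ 2) / (2 * ρ ^ 2) * a ^ 2 + (1 + ρ ^ 2) / (1 - ρ ^ 2) * b ^ 2 - (a + b) ^ 2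
          = ((1 - ρ ^ 2) * a - 2 * ρ ^ 2 * b) ^ 2 / (2 * ρ ^ 2 * (1 - ρ ^ 2)) := by
        field_simp
        ring
      have h' : 0 ≤ ((1 - ρ ^ 2) * a - 2 * ρ ^ 2 * b) ^ 2 / (2 * ρ ^ 2 * (1 - ρ ^ 2)) := by
        positivity
      linarith)
    (SR * (R * X - projR πR * X)) ((-η) • (SR * ((R - projR πR) * V)))
  rw [← e1, frob_smul, neg_sq] at h1
  refine h1.trans ?_
  have k1 : (1 + ρ ^ 2) / (2 * ρ ^ 2) * frobNorm (SR * (R * X - projR πR * X)) ^ 2 ≤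
      (1 + ρ ^ 2) / 2 * frobNorm (SR * (X - projR πR * X)) ^ 2 := by
    refine (mul_le_mul_of_nonneg_left hA (by positivity)).trans (le_of_eq ?_)
    field_simp
  have k2 : frobNorm (SR * ((R - projR πR) * V)) ^ 2 ≤ κ ^ 2 *
      (2 * (δ ^ 2 * frobNorm (SC * (V - projC πC * V)) ^ 2) + 2 * ((n : ℝ) ^ 2 *
      (euclNorm (SR.mulVec πC) ^ 2 * euclNorm (fun j => (1 / (n : ℝ)) * ∑ i, V i j) ^ 2))) :=
    hB.trans (mul_le_mul_of_nonneg_left (by linarith) (by positivity))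
  have k3 := mul_le_mul_of_nonneg_left k2
    (show 0 ≤ (1 + ρ ^ 2) / (1 - ρ ^ 2) * η ^ 2 by positivity)
  refine (add_le_add k1 (le_of_eq_of_le (by ring) k3)).trans (le_of_eq ?_)
  ring
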